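/- arXiv:2208.03864 — 2 statements merged into one kernel-verified Lean document; each statement's English description precedes it below -/
import Mathlib

section
/- Let n = 2t, let i be a positive integer, and let λ = gcd(n,i); assume n/λ is odd (so λ is even and t + λ/2 is even). Let E = {x ∈ F_{2^n} : x^{2^t} = x} (the subfield F_{2^t}). For any μ̃ ∈ F_{2^n}∖{0}, define φ : F_{2^n} → 𝔽₂ by φ(x) = Tr(μ̃·x^{2^i+1}) + 1_E(x). Then for every ν ∈ F_{2^n}, W_φ(ν) lies in the set {0, −2^{t+1}, 2^{(n+λ)/2}, −2^{(n+λ)/2}, 2^{(t+λ/2)/2+1}, −2^{(t+λ/2)/2+1}, 2^{(n+λ)/2}−2^{t+1}, −2^{(n+λ)/2}−2^{t+1}, 2^{(n+λ)/2}+2^{(t+λ/2)/2+1}, 2^{(n+λ)/2}−2^{(t+λ/2)/2+1}, −2^{(n+λ)/2}+2^{(t+λ/2)/2+1}, −2^{(n+λ)/2}−2^{(t+λ/2)/2+1}}. -/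
noncomputable def trK (n : ℕ) (x : GaloisField 2 n) : ZMod 2 :=
  Algebra.trace (ZMod 2) (GaloisField 2 n) x

noncomputable def whtK (n : ℕ) (φ : GaloisField 2 n → ZMod 2) (ν : GaloisField 2 n) : ℤ :=
  letI : Fintype (GaloisField 2 n) := Fintype.ofFinite _
  ∑ x : GaloisField 2 n, (-1 : ℤ) ^ (φ x + trK n (ν * x)).val

noncomputable def wtK (n : ℕ) (c : {x : GaloisField 2 n // x ≠ 0} → ZMod 2) : ℕ :=
  Set.ncard {x : {x : GaloisField 2 n // x ≠ 0} | c x = 1}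

def IsMinimalK (n : ℕ) (C : Set ({x : GaloisField 2 n // x ≠ 0} → ZMod 2)) : Prop :=
  ∀ c ∈ C, ∀ c' ∈ C, c ≠ 0 → c' ≠ 0 →
    {x | c' x = 1} ⊆ {x | c x = 1} → c' = c


def chi (a : ZMod 2) : ℤ := (-1) ^ a.val

lemma chi_add : ∀ a b, chi (a + b) = chi a * chi b := by decide
lemma chi_zero : chi 0 = 1 := by decide
lemma chi_sq : ∀ a, chi a * chi a = 1 := by decide
lemma chi_ne : ∀ a, a ≠ 0 → chi a = -1 := by decide

lemma sum_chi_hom {G : Type*} [AddCommGroup G] [Fintype G] (L : G →+ ZMod 2) :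
    ∑ x, chi (L x) = if L = 0 then (Fintype.card G : ℤ) else 0 := by
  split_ifs with h
  · subst h; simp [chi_zero]
  · have : ∃ g, L g ≠ 0 := by
      by_contra! hh
      exact h (AddMonoidHom.ext hh)
    obtain ⟨g, hg⟩ := this
    have h1 : ∑ x, chi (L x) = ∑ x, chi (L (g + x)) :=
      (Equiv.sum_comp (Equiv.addLeft g) (fun x => chi (L x))).symm
    simp only [map_add, chi_add, chi_ne _ hg, ← Finset.mul_sum] at h1
    linarith

/-- Square of the exponential sum of a quadratic form. -/
lemma quad_sq {G : Type*} [AddCommGroup G] [Fintype G] (Q : G → ZMod 2)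
    (B : G →+ G →+ ZMod 2) (hQ : ∀ x y, Q (x + y) = Q x + Q y + B y x)
    (R : AddSubgroup G) (hR : ∀ y, y ∈ R ↔ B y = 0) :
    (∑ x, chi (Q x)) ^ 2 = 0 ∨
      (∑ x, chi (Q x)) ^ 2 = (Fintype.card G : ℤ) * (Nat.card R : ℤ) := by
  classical
  have h0 : ∀ x : ZMod 2, x + x = 0 := by decide
  have h1 : (∑ x, chi (Q x)) ^ 2 = ∑ y, chi (Q y) * ∑ x, chi (B y x) := by
    rw [sq, Finset.sum_mul]
    have : ∀ x, chi (Q x) * ∑ y, chi (Q y) = ∑ y, chi (Q y) * chi (B y x) := by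
      intro x
      rw [← Equiv.sum_comp (Equiv.addLeft x) (fun y => chi (Q y)), Finset.mul_sum]
      refine Finset.sum_congr rfl fun y _ => ?_
      simp only [Equiv.coe_addLeft, hQ, chi_add]
      linear_combination chi (Q y) * chi (B y x) * chi_sq (Q x)
    rw [Finset.sum_congr rfl fun x _ => this x, Finset.sum_comm]
    simp only [Finset.mul_sum]
  have h2 : (∑ x, chi (Q x)) ^ 2 = (Fintype.card G : ℤ) * ∑ y : R, chi (Q y) := by
    rw [h1]
    simp only [sum_chi_hom, mul_ite, mul_zero, ← hR]
    rw [← Finset.sum_filter, ← Finset.sum_mul, mul_comm]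
    congr 1
    exact Finset.sum_subtype _ (by simp) _
  let L : R →+ ZMod 2 := AddMonoidHom.mk' (fun y => Q y) (by
    intro a b
    have := (hR b).1 b.2
    simp [hQ, this])
  have h3 : ∑ y : R, chi (Q y) = ∑ y : R, chi (L y) := rfl
  rw [h2, h3, sum_chi_hom]
  split_ifs
  · right; simp [Nat.card_eq_fintype_card]
  · left; simp

lemma gcd_two {m i : ℕ} (hi : 0 < i) (hodd : Odd (m / Nat.gcd m i)) :
    Nat.gcd m (2 * i) = Nat.gcd m i := by
  obtain ⟨g, m', i', hg, hc, hm', hi'⟩ := Nat.exists_coprime' (m := m) (n := i) (Nat.gcd_pos_of_pos_right _ hi)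
  have : m / Nat.gcd m i = m' := by
    rw [hm', hi', Nat.gcd_mul_right, hc.gcd_eq_one, one_mul, Nat.mul_div_cancel _ hg]
  rw [this] at hodd
  have h2 : Nat.Coprime m' (2 * i') := Nat.Coprime.mul_right hodd.coprime_two_right hc
  rw [hm', hi', ← mul_assoc, Nat.gcd_mul_right, Nat.gcd_mul_right, hc.gcd_eq_one, h2.gcd_eq_one]

lemma coprime_gold {m i : ℕ} (hi : 0 < i) (hodd : Odd (m / Nat.gcd m i)) :
    Nat.Coprime (2 ^ m - 1) (2 ^ i + 1) := by
  have hm : 0 < m := by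
    rcases Nat.eq_zero_or_pos m with rfl | h
    · simp at hodd
    · exact h
  set g := Nat.gcd (2 ^ m - 1) (2 ^ i + 1) with hg
  have g1 : g ∣ 2 ^ m - 1 := Nat.gcd_dvd_left _ _
  have g2 : g ∣ 2 ^ i + 1 := Nat.gcd_dvd_right _ _
  have g3 : g ∣ 2 ^ (2 * i) - 1 := by
    refine g2.trans ⟨2 ^ i - 1, ?_⟩
    have := Nat.sq_sub_sq (2 ^ i) 1
    rw [← this, ← pow_mul, mul_comm i 2, one_pow]
  have g4 : g ∣ 2 ^ i - 1 := by
    have h := Nat.dvd_gcd g1 g3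
    rw [Nat.pow_sub_one_gcd_pow_sub_one, gcd_two hi hodd] at h
    exact h.trans (Nat.pow_sub_one_dvd_pow_sub_one 2 (Nat.gcd_dvd_right _ _))
  have g5 : g ∣ 2 := by
    have h := Nat.dvd_sub g2 g4
    have : 1 ≤ 2 ^ i := Nat.one_le_two_pow
    have e : 2 ^ i + 1 - (2 ^ i - 1) = 2 := by omega
    rwa [e] at h
  rcases (Nat.dvd_prime Nat.prime_two).1 g5 with h | h
  · exact h
  · exfalso
    rw [h] at g2
    have : 2 ∣ 2 ^ i := dvd_pow_self 2 hi.ne'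
    omega


noncomputable def fixSub (F : Type*) [Field F] [CharP F 2] (j : ℕ) : Subfield F :=
  RingHom.eqLocusField (iterateFrobenius F 2 j) (RingHom.id F)

lemma mem_fixSub {F : Type*} [Field F] [CharP F 2] (j : ℕ) (x : F) :
    x ∈ fixSub F j ↔ x ^ 2 ^ j = x := Iff.rfl

lemma card_fixSub {F : Type*} [Field F] [Finite F] [CharP F 2] {m : ℕ}
    (hm : Nat.card F = 2 ^ m) {j : ℕ} (hj : 0 < j) :
    Nat.card (fixSub F j) = 2 ^ Nat.gcd m j := by
  have e : ∀ u : Fˣ, u ∈ (powMonoidHom (2 ^ j - 1) : Fˣ →* Fˣ).ker ↔ (u : F) ∈ fixSub F j := by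
    intro u
    have h1 : 2 ^ j = (2 ^ j - 1) + 1 := by have : 1 ≤ 2 ^ j := Nat.one_le_two_pow
                                            omega
    rw [mem_fixSub, MonoidHom.mem_ker, powMonoidHom_apply, h1, pow_succ, Units.ext_iff]
    simp
  have h2 : Nat.card (fixSub F j)ˣ = Nat.card (powMonoidHom (2 ^ j - 1) : Fˣ →* Fˣ).ker := by
    refine Nat.card_congr (Equiv.ofBijective
      (fun u => ⟨Units.map (fixSub F j).subtype.toMonoidHom u, (e _).2 (u : fixSub F j).2⟩) ⟨?_, ?_⟩)
    · intro a b h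
      have h' := congrArg (fun z => ((z : Fˣ) : F)) (Subtype.ext_iff.1 h)
      exact Units.ext (Subtype.ext h')
    · rintro ⟨u, hu⟩
      have hu' := (e u).1 hu
      refine ⟨Units.mk0 ⟨u, hu'⟩ (fun h => u.ne_zero (congrArg Subtype.val h)), ?_⟩
      apply Subtype.ext
      apply Units.ext
      rfl
  rw [IsCyclic.card_powMonoidHom_ker, Nat.card_units, Nat.card_units, hm,
    Nat.pow_sub_one_gcd_pow_sub_one] at h2
  have h3 : 0 < Nat.card (fixSub F j) := Nat.card_pos
  have h4 : 1 ≤ 2 ^ Nat.gcd m j := Nat.one_le_two_pow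
  omega

lemma trace_frob {F : Type*} [Field F] [Finite F] [Algebra (ZMod 2) F] (i : ℕ) (x : F) :
    Algebra.trace (ZMod 2) F (x ^ 2 ^ i) = Algebra.trace (ZMod 2) F x := by
  have h := Algebra.trace_eq_of_algEquiv (A := ZMod 2) (FiniteField.frobeniusAlgEquivOfAlgebraic (ZMod 2) F)
  simp only [FiniteField.coe_frobeniusAlgEquivOfAlgebraic, ZMod.card] at h
  induction i with
  | zero => simp
  | succ k ih => rw [pow_succ, pow_mul, h, ih]

lemma trace_nondeg {F : Type*} [Field F] [Finite F] [Algebra (ZMod 2) F] (y : F)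
    (h : ∀ x, Algebra.trace (ZMod 2) F (x * y) = 0) : y = 0 := by
  have := traceForm_nondegenerate (ZMod 2) F
  exact this.2 y h

lemma trace_repr {F : Type*} [Field F] [Finite F] [Algebra (ZMod 2) F] (T : F →+ ZMod 2) :
    ∃ c : F, ∀ x, T x = Algebra.trace (ZMod 2) F (c * x) := by
  have hn := traceForm_nondegenerate (ZMod 2) F
  obtain ⟨c, hc⟩ := (LinearMap.BilinForm.toDual _ hn).surjective (T.toZModLinearMap 2)
  refine ⟨c, fun x => ?_⟩
  have := congrArg (fun f => f x) hc
  exact this.symm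

lemma sq_cases {S : ℤ} {m k : ℕ} (he : Even (m + k))
    (h : S ^ 2 = 0 ∨ S ^ 2 = (2 : ℤ) ^ m * 2 ^ k) :
    S = 0 ∨ S = 2 ^ ((m + k) / 2) ∨ S = - 2 ^ ((m + k) / 2) := by
  rcases h with h | h
  · left; exact pow_eq_zero_iff (two_ne_zero) |>.1 h
  · right
    obtain ⟨r, hr⟩ := he
    have : (m + k) / 2 = r := by omega
    rw [this]
    apply sq_eq_sq_iff_eq_or_eq_neg.1
    rw [h, ← pow_add, hr, ← pow_mul, mul_two]

lemma gold_trace {F : Type*} [Field F] [Fintype F] [Algebra (ZMod 2) F] [CharP F 2] {m i : ℕ}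
    (hm : Nat.card F = 2 ^ m) (hi : 0 < i) (hodd : Odd (m / Nat.gcd m i))
    (L : F →+ ZMod 2) :
    (∑ x, chi (Algebra.trace (ZMod 2) F (x ^ (2 ^ i + 1)) + L x)) ^ 2 = 0 ∨
    (∑ x, chi (Algebra.trace (ZMod 2) F (x ^ (2 ^ i + 1)) + L x)) ^ 2
      = (2 : ℤ) ^ m * 2 ^ (Nat.gcd m i) := by
  have hfr : ∀ x y : F, (x + y) ^ 2 ^ i = x ^ 2 ^ i + y ^ 2 ^ i := fun x y => add_pow_char_pow x y 2 i
  let B : F →+ F →+ ZMod 2 := AddMonoidHom.mk' (fun y => AddMonoidHom.mk'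
    (fun x => Algebra.trace (ZMod 2) F (x ^ 2 ^ i * y + x * y ^ 2 ^ i))
    (by intro a b; rw [← map_add, hfr]; congr 1; ring))
    (by
      intro a b
      ext x
      simp only [AddMonoidHom.mk'_apply, AddMonoidHom.add_apply]
      rw [← map_add, hfr]; congr 1; ring)
  have hB : ∀ x y, B y x = Algebra.trace (ZMod 2) F (x ^ 2 ^ i * (y + y ^ 2 ^ (2 * i))) := by
    intro x y
    have : B y x = Algebra.trace (ZMod 2) F (x ^ 2 ^ i * y + x * y ^ 2 ^ i) := rfl
    rw [this, map_add, ← trace_frob i (x * y ^ 2 ^ i), ← map_add]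
    congr 1
    rw [mul_pow, ← pow_mul, ← pow_add, two_mul, mul_add]
  have key := quad_sq (fun x => Algebra.trace (ZMod 2) F (x ^ (2 ^ i + 1)) + L x) B (by
    intro x y
    have : B y x = Algebra.trace (ZMod 2) F (x ^ 2 ^ i * y + x * y ^ 2 ^ i) := rfl
    have e : (x + y) ^ (2 ^ i + 1) =
        x ^ (2 ^ i + 1) + y ^ (2 ^ i + 1) + (x ^ 2 ^ i * y + x * y ^ 2 ^ i) := by
      rw [pow_succ, hfr]; ring
    simp only [this, e, map_add]
    ring) (fixSub F (2 * i)).toAddSubgroup (by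
    intro y
    change y ^ 2 ^ (2 * i) = y ↔ _
    constructor
    · intro h
      ext x
      rw [hB, h, CharTwo.add_self_eq_zero]; simp
    · intro h
      have : y + y ^ 2 ^ (2 * i) = 0 := by
        apply trace_nondeg
        intro x
        obtain ⟨z, rfl⟩ := (Finite.injective_iff_surjective.1 (iterateFrobenius F 2 i).injective) x
        rw [iterateFrobenius_def, ← hB, h]; rfl
      exact (CharTwo.add_eq_zero.1 this).symm)
  have hc : Nat.card (fixSub F (2 * i)).toAddSubgroup = 2 ^ Nat.gcd m i := by
    rw [← gcd_two hi hodd]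
    exact card_fixSub hm (by omega)
  rw [hc, ← Nat.card_eq_fintype_card, hm] at key
  push_cast at key
  exact key

lemma gold_main {F : Type*} [Field F] [Fintype F] [CharP F 2] {m i : ℕ}
    (hm : Nat.card F = 2 ^ m) (hi : 0 < i) (hodd : Odd (m / Nat.gcd m i))
    (he : Even (m + Nat.gcd m i))
    (T L : F →+ ZMod 2) (hT : T ≠ 0) :
    (∑ x, chi (T (x ^ (2 ^ i + 1)) + L x)) = 0 ∨
    (∑ x, chi (T (x ^ (2 ^ i + 1)) + L x)) = 2 ^ ((m + Nat.gcd m i) / 2) ∨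
    (∑ x, chi (T (x ^ (2 ^ i + 1)) + L x)) = - 2 ^ ((m + Nat.gcd m i) / 2) := by
  letI := ZMod.algebra F 2
  apply sq_cases he
  obtain ⟨c, hc⟩ := trace_repr T
  have hc0 : c ≠ 0 := by
    rintro rfl
    exact hT (AddMonoidHom.ext fun x => by simp [hc])
  have hcop : (Nat.card Fˣ).Coprime (2 ^ i + 1) := by
    rw [Nat.card_units, hm]; exact coprime_gold hi hodd
  obtain ⟨d, hd⟩ := (powCoprime hcop).surjective (Units.mk0 c hc0)
  have hd' : (d : F) ^ (2 ^ i + 1) = c := by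
    have := congrArg Units.val hd
    simpa using this
  have := gold_trace hm hi hodd (L.comp (AddMonoidHom.mulLeft ((d⁻¹ : Fˣ) : F)))
  have e : (∑ x, chi (T (x ^ (2 ^ i + 1)) + L x)) = ∑ x, chi (Algebra.trace (ZMod 2) F (x ^ (2 ^ i + 1)) +
      (L.comp (AddMonoidHom.mulLeft ((d⁻¹ : Fˣ) : F))) x) := by
    refine Eq.trans ?_ (Equiv.sum_comp (Units.mulLeft d) _)
    refine Finset.sum_congr rfl fun x _ => ?_
    simp [hc, ← hd', mul_pow]
  rw [e]
  exact this

open scoped Classical in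
lemma sum_sub_aux {F : Type*} [Field F] [Fintype F] (E : Subfield F) [Fintype E]
    (T L : F →+ ZMod 2) (k : ℕ) (p : F → Prop) (hp : ∀ x, x ∈ E ↔ p x) :
    ∑ x : E, chi (T.comp E.subtype.toAddMonoidHom (x ^ k) + L.comp E.subtype.toAddMonoidHom x) =
      ∑ x : F, if p x then chi (T (x ^ k) + L x) else 0 := by
  rw [← Finset.sum_filter]
  exact (Finset.sum_subtype (p := fun x => x ∈ E) _ (by intro x; simp [hp])
        (fun x => chi (T (x ^ k) + L x))).symm

open scoped Classical in
theorem stmt16 (t n i lam : ℕ) (hn : n = 2 * t) (hi : 0 < i)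
    (hlam : lam = Nat.gcd n i) (hodd : Odd (n / lam))
    (μt : GaloisField 2 n) (hμt : μt ≠ 0)
    (φ : GaloisField 2 n → ZMod 2)
    (hφ : ∀ x, φ x = trK n (μt * x ^ (2 ^ i + 1))
      + (if x ^ (2 ^ t) = x then (1 : ZMod 2) else 0)) :
    ∀ ν : GaloisField 2 n,
      whtK n φ ν ∈ ({0, -2 ^ (t + 1),
        2 ^ ((n + lam) / 2), -2 ^ ((n + lam) / 2),
        2 ^ ((t + lam / 2) / 2 + 1), -2 ^ ((t + lam / 2) / 2 + 1),
        2 ^ ((n + lam) / 2) - 2 ^ (t + 1), -2 ^ ((n + lam) / 2) - 2 ^ (t + 1),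
        2 ^ ((n + lam) / 2) + 2 ^ ((t + lam / 2) / 2 + 1),
        2 ^ ((n + lam) / 2) - 2 ^ ((t + lam / 2) / 2 + 1),
        -2 ^ ((n + lam) / 2) + 2 ^ ((t + lam / 2) / 2 + 1),
        -2 ^ ((n + lam) / 2) - 2 ^ ((t + lam / 2) / 2 + 1)} : Set ℤ) := by
  intro ν
  letI : Fintype (GaloisField 2 n) := Fintype.ofFinite _
  have hn0 : n ≠ 0 := by
    rintro h
    rw [h] at hodd
    simp at hodd
  have ht0 : 0 < t := by omega
  -- arithmetic of the gcds
  have hldvd : lam ∣ n := hlam ▸ Nat.gcd_dvd_left _ _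
  have hli : lam ∣ i := hlam ▸ Nat.gcd_dvd_right _ _
  obtain ⟨k, hk⟩ := hldvd
  have hlpos : 0 < lam := hlam ▸ Nat.gcd_pos_of_pos_right _ hi
  have hkdiv : n / lam = k := by rw [hk, Nat.mul_div_cancel_left _ hlpos]
  rw [hkdiv] at hodd
  have hleven : Even lam := by
    have : Even (lam * k) := by rw [← hk, hn]; exact even_two_mul t
    rcases Nat.even_mul.1 this with h | h
    · exact h
    · exact absurd h (Nat.not_even_iff_odd.2 hodd)
  obtain ⟨l, hl⟩ := hleven
  have hl2 : lam / 2 = l := by omega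
  have htk : t = l * k := by
    have : 2 * t = 2 * (l * k) := by rw [← hn, hk, hl]; ring
    omega
  have hlp : 0 < l := by omega
  have hgt : Nat.gcd t i = l := by
    obtain ⟨j, hj⟩ := hli
    have h1 : Nat.gcd k j = 1 := by
      have h := hlam
      rw [hk, hj, Nat.gcd_mul_left] at h
      exact Nat.eq_of_mul_eq_mul_left hlpos (by rw [← h, mul_one])
    have h2 : Nat.Coprime k (2 * j) := Nat.Coprime.mul_right hodd.coprime_two_right h1
    have h3 : i = l * (2 * j) := by rw [hj, hl]; ring
    rw [htk, h3, Nat.gcd_mul_left, h2.gcd_eq_one, mul_one]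
  have hcardK : Nat.card (GaloisField 2 n) = 2 ^ n := GaloisField.card 2 n hn0
  let E := fixSub (GaloisField 2 n) t
  have hcardE : Nat.card E = 2 ^ t := by
    have := card_fixSub hcardK ht0
    have hg : Nat.gcd n t = t := by rw [hn, Nat.gcd_mul_left_left]
    rwa [hg] at this
  letI : Fintype E := Fintype.ofFinite _
  let T : GaloisField 2 n →+ ZMod 2 :=
    (Algebra.trace (ZMod 2) (GaloisField 2 n)).toAddMonoidHom.comp (AddMonoidHom.mulLeft μt)
  let L : GaloisField 2 n →+ ZMod 2 :=
    (Algebra.trace (ZMod 2) (GaloisField 2 n)).toAddMonoidHom.comp (AddMonoidHom.mulLeft ν)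
  have hTa : ∀ x, T x = trK n (μt * x) := fun x => rfl
  have hLa : ∀ x, L x = trK n (ν * x) := fun x => rfl
  have hT : T ≠ 0 := by
    intro h
    apply hμt
    apply trace_nondeg
    intro x
    rw [mul_comm]
    exact congrArg (fun f => f x) h
  let T' : E →+ ZMod 2 := T.comp E.subtype.toAddMonoidHom
  let L' : E →+ ZMod 2 := L.comp E.subtype.toAddMonoidHom
  set S := ∑ x, chi (T (x ^ (2 ^ i + 1)) + L x) with hS
  set S' := ∑ x : E, chi (T' (x ^ (2 ^ i + 1)) + L' x) with hS'
  have hW : whtK n φ ν = S - 2 * S' := by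
    have h1 : whtK n φ ν = ∑ x, chi (φ x + trK n (ν * x)) := rfl
    have h2 : S' = ∑ x : GaloisField 2 n,
        if x ^ 2 ^ t = x then chi (T (x ^ (2 ^ i + 1)) + L x) else 0 :=
      sum_sub_aux E T L (2 ^ i + 1) (fun x => x ^ 2 ^ t = x) (fun x => mem_fixSub t x)
    rw [h1, h2, hS, Finset.mul_sum, ← Finset.sum_sub_distrib]
    refine Finset.sum_congr rfl fun x _ => ?_
    rw [hφ, hTa, hLa]
    have h11 : chi 1 = -1 := by decide
    split_ifs
    · rw [chi_add, chi_add, chi_add, h11]; ring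
    · simp
  have hSc : S = 0 ∨ S = 2 ^ ((n + lam) / 2) ∨ S = - 2 ^ ((n + lam) / 2) := by
    have := gold_main hcardK hi (by rw [← hlam, hkdiv]; exact hodd)
      (by rw [← hlam, hn, hl]; exact ⟨t + l, by ring⟩) T L hT
    rwa [← hlam] at this
  have hSc' : S' = 0 ∨ S' = 2 ^ t ∨ S' = 2 ^ ((t + lam / 2) / 2) ∨
      S' = - 2 ^ ((t + lam / 2) / 2) := by
    by_cases hT' : T' = 0
    · have : S' = ∑ x : E, chi (L' x) := by rw [hS', hT']; simp
      rw [this, sum_chi_hom, ← Nat.card_eq_fintype_card, hcardE]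
      split_ifs
      · right; left; push_cast; rfl
      · left; rfl
    · have := gold_main hcardE hi
        (by rw [hgt, htk, Nat.mul_div_cancel_left _ hlp]; exact hodd)
        (by
          rw [hgt, htk]
          obtain ⟨r, hr⟩ := hodd
          exact ⟨l * (r + 1), by rw [hr]; ring⟩) T' L' hT'
      rw [hgt, ← hl2] at this
      rcases this with h | h | h
      · left; exact h
      · right; right; left; exact h
      · right; right; right; exact h
  rw [hW]
  simp only [Set.mem_insert_iff, Set.mem_singleton_iff]
  rw [pow_succ, pow_succ]
  generalize (2 : ℤ) ^ ((n + lam) / 2) = A at *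
  generalize (2 : ℤ) ^ ((t + lam / 2) / 2) = B at *
  generalize (2 : ℤ) ^ t = C at *
  clear_value S S'
  rcases hSc with rfl | rfl | rfl <;> rcases hSc' with rfl | rfl | rfl | rfl <;> grind
end

section
/- Let n = 2t > 8, let 2 ≤ i ≤ n−1, and let λ = gcd(n,i) with n/λ odd. Let E = {x ∈ F_{2^n} : x^{2^t} = x} (the subfield F_{2^t}) and let a, b ∈ F_{2^n}∖E with a+b ∉ E. Define f : F_{2^n} → 𝔽₂ by f(x) = 1_E(x) + Tr(ax)·Tr(bx) + 1, and consider the binary code C_F of length 2ⁿ−1 whose codewords are c(μ₁,μ̃,ν) : F_{2^n}∖{0} → 𝔽₂, c(μ₁,μ̃,ν)(x) = μ₁·f(x) + Tr(μ̃·x^{2^i+1}) + Tr(νx), for (μ₁,μ̃,ν) ∈ 𝔽₂ × F_{2^n} × F_{2^n}. Then C_F is a minimal linear code, has exactly 2^{2n+1} codewords (dimension 2n+1), its minimum nonzero Hamming weight equals 2^{n−2} + 2^{t−1}, and it violates the AB condition: 2·w_min ≤ w_max, where w_min and w_max are the minimum and maximum Hamming weights of nonzero codewords of C_F. -/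
noncomputable def cwG (n i : ℕ) (f : GaloisField 2 n → ZMod 2)
    (μ₁ : ZMod 2) (μt ν : GaloisField 2 n) :
    {x : GaloisField 2 n // x ≠ 0} → ZMod 2 :=
  fun x => μ₁ * f x.1 + trK n (μt * x.1 ^ (2 ^ i + 1)) + trK n (ν * x.1)

noncomputable def codeG (n i : ℕ) (f : GaloisField 2 n → ZMod 2) :
    Set ({x : GaloisField 2 n // x ≠ 0} → ZMod 2) :=
  Set.range fun p : ZMod 2 × GaloisField 2 n × GaloisField 2 n =>
    cwG n i f p.1 p.2.1 p.2.2

def weightsG (n i : ℕ) (f : GaloisField 2 n → ZMod 2) : Set ℕ :=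
  {w | ∃ c ∈ codeG n i f, c ≠ 0 ∧ wtK n c = w}

open Finset

/-- The additive sign character of the field with two elements. -/
def sgn (u : ZMod 2) : ℤ := if u = 0 then 1 else -1

lemma sgn_add (u v : ZMod 2) : sgn (u + v) = sgn u * sgn v := by
  revert u v; decide

lemma sgn_zero : sgn 0 = 1 := by decide

lemma sgn_abs (u : ZMod 2) : |sgn u| = 1 := by
  revert u; decide

section fieldLemmas

set_option linter.unusedSectionVars false

variable {F : Type*} [Field F] [Fintype F] [Algebra (ZMod 2) F] [CharP F 2]

/-- The absolute trace. -/
noncomputable def tr (x : F) : ZMod 2 := Algebra.trace (ZMod 2) F x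

lemma tr_add (x y : F) : tr (x + y) = tr x + tr y := by simp [tr]

lemma tr_zero : tr (0 : F) = 0 := by simp [tr]

lemma tr_pow (k : ℕ) (x : F) : tr (x ^ 2 ^ k) = tr x := by
  induction k with
  | zero => simp
  | succ k ih =>
    rw [← ih, pow_succ, pow_mul]
    have h := Algebra.trace_eq_of_algEquiv (FiniteField.frobeniusAlgEquiv (ZMod 2) F 2) (x ^ 2 ^ k)
    simpa [tr] using h

lemma tr_nondeg {z : F} (hz : z ≠ 0) : ∃ x, tr (z * x) = 1 := by
  by_contra! h
  apply hz
  have h2 : ∀ x, tr (z * x) = 0 := by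
    intro x
    have := h x
    generalize tr (z * x) = u at *
    revert u; decide
  have := traceForm_nondegenerate (ZMod 2) F
  exact this.1 z (fun x => by simpa [tr, Algebra.traceForm_apply] using h2 x)

/-- Orthogonality on a set closed under addition of one element of odd trace. -/
lemma sum_sgn_eq_zero (E : Finset F) (z e : F) (he : tr (z * e) = 1)
    (hE : ∀ x ∈ E, x + e ∈ E) : ∑ x ∈ E, sgn (tr (z * x)) = 0 := by
  have h : ∑ x ∈ E, sgn (tr (z * x)) = ∑ x ∈ E, - sgn (tr (z * x)) := by
    refine Finset.sum_bij' (fun x _ => x + e) (fun x _ => x + e) hE hE ?_ ?_ ?_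
    · intro x _; rw [add_assoc, CharTwo.add_self_eq_zero, add_zero]
    · intro x _; rw [add_assoc, CharTwo.add_self_eq_zero, add_zero]
    · intro x _
      rw [mul_add, tr_add, he, sgn_add]
      have : sgn 1 = -1 := by decide
      rw [this]; ring
  rw [Finset.sum_neg_distrib] at h
  linarith

lemma sum_sgn_univ_zero {z : F} (hz : z ≠ 0) : ∑ x : F, sgn (tr (z * x)) = 0 := by
  obtain ⟨e, he⟩ := tr_nondeg hz
  exact sum_sgn_eq_zero _ z e he (fun _ _ => Finset.mem_univ _)

open scoped Classical in
lemma sum_sgn_univ (z : F) :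
    ∑ x : F, sgn (tr (z * x)) = if z = 0 then (Fintype.card F : ℤ) else 0 := by
  split_ifs with h
  · simp [h, tr_zero, sgn_zero]
  · exact sum_sgn_univ_zero h

open scoped Classical in
lemma card_fix_le (g : ℕ) (hg : g ≠ 0) :
    #{x : F | x ^ 2 ^ g = x} ≤ 2 ^ g := by
  have hd := FiniteField.X_pow_card_pow_sub_X_natDegree_eq F (n := g) hg one_lt_two
  refine le_trans ?_ hd.le
  apply Polynomial.card_le_degree_of_subset_roots
  intro x hx
  have hx : x ∈ ({x : F | x ^ 2 ^ g = x} : Finset F) := hx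
  simp only [Finset.mem_filter, Finset.mem_univ, true_and] at hx
  rw [Polynomial.mem_roots (FiniteField.X_pow_card_pow_sub_X_ne_zero F hg one_lt_two)]
  simp [hx]

lemma pow_card' (n : ℕ) (hc : Fintype.card F = 2 ^ n) (x : F) : x ^ 2 ^ n = x := by
  rw [← hc]; exact FiniteField.pow_card x

open scoped Classical in
lemma card_E (t : ℕ) (ht : t ≠ 0) (hc : Fintype.card F = 2 ^ (2 * t)) :
    #{x : F | x ^ 2 ^ t = x} = 2 ^ t := by
  apply le_antisymm (card_fix_le t ht)
  let φ : F →+ F :=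
    { toFun := fun x => x + x ^ 2 ^ t
      map_zero' := by simp
      map_add' := by intro x y; rw [add_pow_char_pow]; ring }
  have hE : Nat.card {x : F | x ^ 2 ^ t = x} = #{x : F | x ^ 2 ^ t = x} := by
    rw [Nat.card_eq_card_toFinset]; simp
  have hk : Nat.card φ.ker = #{x : F | x ^ 2 ^ t = x} := by
    rw [← hE]
    apply Nat.card_congr
    apply Equiv.setCongr
    ext x
    simp only [SetLike.mem_coe, AddMonoidHom.mem_ker, Set.mem_ofPred_eq]
    change x + x ^ 2 ^ t = 0 ↔ _
    rw [CharTwo.add_eq_zero, eq_comm]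
  have hr : Nat.card φ.range ≤ #{x : F | x ^ 2 ^ t = x} := by
    rw [← hE]
    apply Nat.card_mono (Set.toFinite _)
    rintro _ ⟨x, rfl⟩
    change (x + x ^ 2 ^ t) ^ 2 ^ t = x + x ^ 2 ^ t
    rw [add_pow_char_pow, ← pow_mul, ← pow_add, ← two_mul, pow_card' _ hc, add_comm]
  have h := φ.ker.card_mul_index
  rw [AddSubgroup.index_ker, hk, Nat.card_eq_fintype_card (α := F), hc] at h
  by_contra! hlt
  have : (2 : ℕ) ^ (2 * t) < 2 ^ t * 2 ^ t := by
    rw [← h]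
    exact Nat.mul_lt_mul'' hlt (lt_of_le_of_lt hr hlt)
  rw [← pow_add, ← two_mul] at this
  exact lt_irrefl _ this

open scoped Classical in
lemma sum_sgn_E (t : ℕ) (hc : Fintype.card F = 2 ^ (2 * t)) (z : F) (hz : ¬ z ^ 2 ^ t = z) :
    ∑ x : F with x ^ 2 ^ t = x, sgn (tr (z * x)) = 0 := by
  have hz' : z + z ^ 2 ^ t ≠ 0 := by
    rw [Ne, CharTwo.add_eq_zero]; exact fun h => hz h.symm
  obtain ⟨y, hy⟩ := tr_nondeg hz'
  have hyE : (y + y ^ 2 ^ t) ^ 2 ^ t = y + y ^ 2 ^ t := by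
    rw [add_pow_char_pow, ← pow_mul, ← pow_add, ← two_mul, pow_card' _ hc, add_comm]
  apply sum_sgn_eq_zero _ z (y + y ^ 2 ^ t)
  · rw [← hy, mul_add, add_mul, tr_add, tr_add, ← tr_pow t (z * y ^ 2 ^ t), mul_pow,
      ← pow_mul, ← pow_add, ← two_mul, pow_card' _ hc]
  · intro x hx
    simp only [Finset.mem_filter, Finset.mem_univ, true_and] at hx ⊢
    rw [add_pow_char_pow, hyE, hx]

/-- Walsh sum of the Gold function. -/
noncomputable def wal (i : ℕ) (μ ν : F) : ℤ :=
  ∑ x : F, sgn (tr (μ * x ^ (2 ^ i + 1)) + tr (ν * x))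

open scoped Classical in
lemma card_R (n i : ℕ) (hi : i ≤ n) (hn : n ≠ 0) (hc : Fintype.card F = 2 ^ n) (μ : F)
    (hμ : μ ≠ 0) :
    #{y : F | (μ * y) ^ 2 ^ (n - i) + μ * y ^ 2 ^ i = 0} ≤ 2 ^ Nat.gcd (2 * i) n := by
  have hg : Nat.gcd (2 * i) n ≠ 0 := by
    intro h; exact hn (Nat.eq_zero_of_gcd_eq_zero_right h)
  have key : ∀ y : F, (μ * y) ^ 2 ^ (n - i) + μ * y ^ 2 ^ i = 0 →
      μ * y = μ ^ 2 ^ i * y ^ 2 ^ (2 * i) := by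
    intro y hy
    rw [CharTwo.add_eq_zero] at hy
    have := congrArg (fun z => z ^ 2 ^ i) hy
    rw [← pow_mul, ← pow_add, Nat.sub_add_cancel hi, pow_card' n hc, mul_pow, ← pow_mul,
      ← pow_add, ← two_mul] at this
    exact this
  by_cases hz : ∃ z : F, z ≠ 0 ∧ (μ * z) ^ 2 ^ (n - i) + μ * z ^ 2 ^ i = 0
  · obtain ⟨z, hz0, hz⟩ := hz
    refine le_trans ?_ (card_fix_le (F := F) _ hg)
    apply Finset.card_le_card_of_injOn (fun y => y / z)
    · intro y hy
      have hy : y ∈ ({y : F | (μ * y) ^ 2 ^ (n - i) + μ * y ^ 2 ^ i = 0} : Finset F) := hy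
      simp only [Finset.mem_filter, Finset.mem_univ, true_and] at hy
      simp only [Finset.coe_filter, Finset.mem_univ, true_and, Set.mem_ofPred_eq]
      have h1 : (y / z) ^ 2 ^ (2 * i) = y / z := by
        have e1 := key y hy
        have e2 := key z hz
        have hμi : μ ^ 2 ^ i ≠ 0 := pow_ne_zero _ hμ
        have hzi : z ^ 2 ^ (2 * i) ≠ 0 := pow_ne_zero _ hz0
        rw [div_pow, div_eq_div_iff hzi hz0]
        apply mul_left_cancel₀ hμ
        apply mul_left_cancel₀ hμi
        calc μ ^ 2 ^ i * (μ * (y ^ 2 ^ (2 * i) * z))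
            = (μ ^ 2 ^ i * y ^ 2 ^ (2 * i)) * (μ * z) := by ring
          _ = (μ * y) * (μ ^ 2 ^ i * z ^ 2 ^ (2 * i)) := by rw [← e1, ← e2]
          _ = _ := by ring
      have h2 := pow_card' n hc (y / z)
      have p1 : Function.IsPeriodicPt (frobenius F 2) (2 * i) (y / z) := by
        rw [Function.IsPeriodicPt, Function.IsFixedPt, iterate_frobenius]; exact h1
      have p2 : Function.IsPeriodicPt (frobenius F 2) n (y / z) := by
        rw [Function.IsPeriodicPt, Function.IsFixedPt, iterate_frobenius]; exact h2
      have p3 := p1.gcd p2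
      rwa [Function.IsPeriodicPt, Function.IsFixedPt, iterate_frobenius] at p3
    · intro y _ y' _ h
      exact (div_left_inj' hz0).mp h
  · push Not at hz
    refine le_trans ?_ (Nat.one_le_two_pow)
    rw [Finset.card_le_one]
    intro x hx y hy
    simp only [Finset.mem_filter, Finset.mem_univ, true_and] at hx hy
    have : ∀ x : F, (μ * x) ^ 2 ^ (n - i) + μ * x ^ 2 ^ i = 0 → x = 0 := by
      intro x hx
      by_contra h
      exact hz x h hx
    rw [this x hx, this y hy]

open scoped Classical in
lemma wal_sq (n i : ℕ) (hi : i ≤ n) (hc : Fintype.card F = 2 ^ n) (μ ν : F) :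
    wal i μ ν * wal i μ ν ≤
      2 ^ n * #{y : F | (μ * y) ^ 2 ^ (n - i) + μ * y ^ 2 ^ i = 0} := by
  set h : F → ZMod 2 := fun x => tr (μ * x ^ (2 ^ i + 1)) + tr (ν * x) with hh
  have hadd : ∀ x y, h x + h (y + x) = h y + tr (((μ * y) ^ 2 ^ (n - i) + μ * y ^ 2 ^ i) * x) := by
    intro x y
    have e1 : tr ((μ * y) ^ 2 ^ (n - i) * x) = tr (μ * y * x ^ 2 ^ i) := by
      rw [← tr_pow i ((μ * y) ^ 2 ^ (n - i) * x), mul_pow, ← pow_mul, ← pow_add,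
        Nat.sub_add_cancel hi, pow_card' n hc]
    rw [add_mul, tr_add, e1]
    simp only [hh]
    have e2 : μ * (y + x) ^ (2 ^ i + 1) = μ * y ^ (2 ^ i + 1) + μ * x ^ (2 ^ i + 1)
        + (μ * y * x ^ 2 ^ i + μ * y ^ 2 ^ i * x) := by
      rw [pow_succ (y + x), add_pow_char_pow]; ring
    rw [e2, mul_add]
    simp only [tr_add]
    have : ∀ a b c d e f : ZMod 2, a + b + (c + a + (d + e) + (f + b)) = c + f + (d + e) := by
      decide
    exact this _ _ _ _ _ _
  have e : wal i μ ν * wal i μ ν = ∑ y : F, sgn (h y) *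
      ∑ x : F, sgn (tr (((μ * y) ^ 2 ^ (n - i) + μ * y ^ 2 ^ i) * x)) := by
    have : wal i μ ν * wal i μ ν = ∑ x : F, ∑ y : F, sgn (h x) * sgn (h y) := by
      rw [← Finset.sum_mul_sum]; rfl
    rw [this]
    have : ∀ x : F, ∑ y : F, sgn (h x) * sgn (h y) = ∑ y : F, sgn (h x) * sgn (h (y + x)) := by
      intro x
      exact (Equiv.sum_comp (Equiv.addRight x) (fun y => sgn (h x) * sgn (h y))).symm
    simp_rw [this]
    rw [Finset.sum_comm]
    apply Finset.sum_congr rfl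
    intro y _
    rw [Finset.mul_sum]
    apply Finset.sum_congr rfl
    intro x _
    rw [← sgn_add, ← sgn_add, hadd]
  rw [e]
  simp_rw [sum_sgn_univ, hc]
  calc _ ≤ ∑ y : F, (if (μ * y) ^ 2 ^ (n - i) + μ * y ^ 2 ^ i = 0 then ((2 : ℤ) ^ n) else 0) := by
        apply Finset.sum_le_sum
        intro y _
        have := sgn_abs (h y)
        have h3 := le_abs_self (sgn (h y))
        split_ifs
        · push_cast
          have : (0 : ℤ) ≤ 2 ^ n := by positivity
          nlinarith
        · simp
    _ = _ := by
        rw [Finset.sum_ite, Finset.sum_const_zero, add_zero, Finset.sum_const, nsmul_eq_mul,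
          mul_comm]

lemma wal_bound (n i : ℕ) (hi : i ≤ n) (hn : 8 ≤ n) (hc : Fintype.card F = 2 ^ n)
    (hg : Nat.gcd (2 * i) n ≤ n - 8) (μ ν : F) (hμ : μ ≠ 0) :
    |wal i μ ν| ≤ 2 ^ (n - 4) := by
  classical
  apply abs_le_of_sq_le_sq _ (by positivity)
  have h1 := wal_sq n i hi hc μ ν
  have h2 := card_R n i hi (by lia) hc μ hμ
  have h3 : (2 : ℕ) ^ Nat.gcd (2 * i) n ≤ 2 ^ (n - 8) := Nat.pow_le_pow_right (by norm_num) hg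
  have h4 : ((#{y : F | (μ * y) ^ 2 ^ (n - i) + μ * y ^ 2 ^ i = 0} : ℕ) : ℤ) ≤ 2 ^ (n - 8) := by
    exact_mod_cast h2.trans h3
  have h5 : ((2 : ℤ) ^ (n - 4)) ^ 2 = 2 ^ n * 2 ^ (n - 8) := by
    rw [← pow_mul, ← pow_add]; congr 1; lia
  rw [h5, sq]
  refine h1.trans ?_
  gcongr

lemma wal_zero (i : ℕ) (ν : F) (hν : ν ≠ 0) : wal i 0 ν = 0 := by
  simp only [wal, zero_mul, tr_zero, zero_add]
  exact sum_sgn_univ_zero hν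

lemma wal_zero_zero (n i : ℕ) (hc : Fintype.card F = 2 ^ n) : wal i (0 : F) 0 = 2 ^ n := by
  simp [wal, tr_zero, sgn_zero, hc]

end fieldLemmas

lemma gcd_bound (t n i : ℕ) (hn : n = 2 * t) (hn8 : 8 < n) (hi1 : 2 ≤ i) (hi2 : i ≤ n - 1)
    (hodd : Odd (n / Nat.gcd n i)) : Nat.gcd (2 * i) n ≤ n - 8 := by
  obtain ⟨g, hg⟩ : ∃ g, g = Nat.gcd n i := ⟨_, rfl⟩
  rw [← hg] at hodd
  have hgn : g ∣ n := hg ▸ Nat.gcd_dvd_left n i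
  have hgi : g ∣ i := hg ▸ Nat.gcd_dvd_right n i
  have hg0 : 0 < g := Nat.pos_of_dvd_of_pos hgn (by lia)
  obtain ⟨m, hm⟩ := hgn
  obtain ⟨j, hj⟩ := hgi
  have hmd : n / g = m := by rw [hm]; exact Nat.mul_div_cancel_left m hg0
  rw [hmd] at hodd
  have hcop : Nat.gcd m j = 1 := by
    have : g * Nat.gcd m j = g * 1 := by
      rw [← Nat.gcd_mul_left, ← hm, ← hj, mul_one, ← hg]
    exact Nat.eq_of_mul_eq_mul_left hg0 this
  have h2m : Nat.Coprime 2 m := (Nat.coprime_two_left).mpr hodd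
  have e : Nat.gcd (2 * i) n = g := by
    rw [hj, hm, show 2 * (g * j) = g * (2 * j) by ring, Nat.gcd_mul_left]
    have : Nat.Coprime (2 * j) m := Nat.Coprime.mul_left h2m (Nat.Coprime.symm hcop)
    rw [this, mul_one]
  rw [e]
  have hev : Even g := by
    have : Even (g * m) := by rw [← hm, hn]; simp
    rcases Nat.even_mul.mp this with h | h
    · exact h
    · exact absurd hodd (Nat.not_odd_iff_even.mpr h)
  have hm3 : 3 ≤ m := by
    obtain ⟨k, hk⟩ := hodd
    rcases Nat.eq_zero_or_pos k with h | h
    · exfalso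
      subst h
      have : n ∣ i := by rw [hm, hk, hj]; simp
      have := Nat.le_of_dvd (by lia) this
      lia
    · lia
  obtain ⟨k, hk⟩ := hev
  have : g * 3 ≤ n := by rw [hm]; exact Nat.mul_le_mul_left g hm3
  lia

section sums

set_option linter.unusedSectionVars false

variable {F : Type*} [Field F] [Fintype F] [Algebra (ZMod 2) F] [CharP F 2]

/-- Codeword extended to the whole field. -/
noncomputable def ph (i : ℕ) (f : F → ZMod 2) (μ₁ : ZMod 2) (μ ν x : F) : ZMod 2 :=
  μ₁ * f x + tr (μ * x ^ (2 ^ i + 1)) + tr (ν * x)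

/-- Signed sum of an extended codeword. -/
noncomputable def gs (i : ℕ) (f : F → ZMod 2) (μ₁ : ZMod 2) (μ ν : F) : ℤ :=
  ∑ x : F, sgn (ph i f μ₁ μ ν x)

lemma gs_zero (i : ℕ) (f : F → ZMod 2) (μ ν : F) : gs i f 0 μ ν = wal i μ ν := by
  simp [gs, ph, wal]

open scoped Classical in
/-- The part of the sum supported on the subfield. -/
noncomputable def se (t i : ℕ) (a b μ ν : F) : ℤ :=
  ∑ x : F with x ^ 2 ^ t = x,
    sgn (tr (a * x) * tr (b * x) + (tr (μ * x ^ (2 ^ i + 1)) + tr (ν * x)))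

open scoped Classical in
lemma gs_one (t i : ℕ) (a b : F) (f : F → ZMod 2)
    (hf : ∀ x, f x = (if x ^ (2 ^ t) = x then (1 : ZMod 2) else 0)
      + tr (a * x) * tr (b * x) + 1) (μ ν : F) :
    2 * gs i f 1 μ ν = -(wal i μ ν + wal i μ (ν + a) + wal i μ (ν + b) - wal i μ (ν + a + b))
      + 4 * se t i a b μ ν := by
  rw [gs, se, wal, wal, wal, wal, Finset.sum_filter, Finset.mul_sum, Finset.mul_sum,
    ← Finset.sum_add_distrib, ← Finset.sum_add_distrib, ← Finset.sum_sub_distrib,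
    ← Finset.sum_neg_distrib, ← Finset.sum_add_distrib]
  apply Finset.sum_congr rfl
  intro x _
  simp only [ph, hf, add_mul, tr_add]
  generalize tr (a * x) = u
  generalize tr (b * x) = v
  generalize tr (μ * x ^ (2 ^ i + 1)) = w
  generalize tr (ν * x) = z
  split_ifs
  · revert u v w z; decide
  · revert u v w z; decide

lemma se_bound (t i : ℕ) (ht : t ≠ 0) (a b μ ν : F) : |se t i a b μ ν| ≤ 2 ^ t := by
  classical
  have h := card_fix_le (F := F) t ht
  refine (Finset.abs_sum_le_sum_abs _ _).trans ?_
  simp_rw [sgn_abs]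
  rw [Finset.sum_const, nsmul_eq_mul, mul_one]
  have : (#{x : F | x ^ 2 ^ t = x} : ℤ) ≤ ((2 ^ t : ℕ) : ℤ) := by exact_mod_cast h
  push_cast at this
  convert this

open scoped Classical in
lemma se_zero (t i : ℕ) (a b ν : F) :
    2 * se t i a b 0 ν = ∑ x : F with x ^ 2 ^ t = x, sgn (tr (ν * x))
      + ∑ x : F with x ^ 2 ^ t = x, sgn (tr ((ν + a) * x))
      + ∑ x : F with x ^ 2 ^ t = x, sgn (tr ((ν + b) * x))
      - ∑ x : F with x ^ 2 ^ t = x, sgn (tr ((ν + a + b) * x)) := by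
  rw [se, Finset.mul_sum, ← Finset.sum_add_distrib, ← Finset.sum_add_distrib,
    ← Finset.sum_sub_distrib]
  apply Finset.sum_congr rfl
  intro x _
  simp only [add_mul, tr_add, zero_mul, tr_zero]
  generalize tr (a * x) = u
  generalize tr (b * x) = v
  generalize tr (ν * x) = z
  revert u v z; decide

open scoped Classical in
lemma sum_E_zero (t : ℕ) (ht : t ≠ 0) (hc : Fintype.card F = 2 ^ (2 * t)) :
    ∑ x : F with x ^ 2 ^ t = x, sgn (tr ((0 : F) * x)) = 2 ^ t := by
  have := card_E (F := F) t ht hc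
  simp only [zero_mul, tr_zero, sgn_zero, Finset.sum_const, this]
  simp

lemma add_self3 (a b : F) : a + b + a + b = 0 := by
  rw [show a + b + a + b = (a + a) + (b + b) by ring]; simp [CharTwo.add_self_eq_zero]

lemma add_self2 (a b : F) : a + b + a = b := by
  rw [show a + b + a = (a + a) + b by ring]; simp [CharTwo.add_self_eq_zero]

lemma add_self2' (a b : F) : a + b + b = a := by
  rw [add_assoc]; simp [CharTwo.add_self_eq_zero]

/-- Exact values at the four special points and a bound elsewhere. -/
lemma special (t i : ℕ) (ht : 5 ≤ t) (hc : Fintype.card F = 2 ^ (2 * t)) (a b : F)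
    (haE : ¬ a ^ (2 ^ t) = a) (hbE : ¬ b ^ (2 ^ t) = b) (habE : ¬ (a + b) ^ (2 ^ t) = a + b) 
    (f : F → ZMod 2) 
    (h1 : ∀ μ ν, 2 * gs i f 1 μ ν =
      -(wal i μ ν + wal i μ (ν + a) + wal i μ (ν + b) - wal i μ (ν + a + b))
      + 4 * se t i a b μ ν) :
    2 * gs i f 1 0 (a + b) = 2 ^ (2 * t) - 2 * 2 ^ t ∧
    2 * gs i f 1 0 0 = -(2 ^ (2 * t) - 2 * 2 ^ t) ∧
    ∀ ν, |2 * gs i f 1 0 ν| ≤ 2 ^ (2 * t) - 2 * 2 ^ t := by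
  classical
  have ht0 : t ≠ 0 := by lia
  have hz : ∀ z : F, ¬ z ^ 2 ^ t = z → z ≠ 0 := by
    rintro z h rfl; simp at h
  have wa := wal_zero i a (hz a haE)
  have wb := wal_zero i b (hz b hbE)
  have wab := wal_zero i (a + b) (hz _ habE)
  have w0 := wal_zero_zero (F := F) (2 * t) i hc
  have sa := sum_sgn_E t hc a haE
  have sb := sum_sgn_E t hc b hbE
  have sab := sum_sgn_E t hc (a + b) habE
  have s0 := sum_E_zero (F := F) t ht0 hc
  have A : 2 * gs i f 1 0 (a + b) = 2 ^ (2 * t) - 2 * 2 ^ t := by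
    have e := se_zero t i a b (a + b)
    have e1 := h1 0 (a + b)
    rw [add_self3, add_self2, add_self2'] at e e1
    rw [sa, sb, sab, s0] at e
    rw [wa, wb, wab, w0] at e1
    linarith
  have B : 2 * gs i f 1 0 0 = -(2 ^ (2 * t) - 2 * 2 ^ t) := by
    have e := se_zero t i a b 0
    have e1 := h1 0 0
    rw [zero_add, zero_add] at e e1
    rw [sa, sb, sab, s0] at e
    rw [wa, wb, wab, w0] at e1
    linarith
  have C : 2 * gs i f 1 0 a = -(2 ^ (2 * t) - 2 * 2 ^ t) := by
    have e := se_zero t i a b a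
    have e1 := h1 0 a
    rw [CharTwo.add_self_eq_zero, zero_add] at e e1
    rw [sa, sb, sab, s0] at e
    rw [wa, wb, wab, w0] at e1
    linarith
  have D : 2 * gs i f 1 0 b = -(2 ^ (2 * t) - 2 * 2 ^ t) := by
    have e := se_zero t i a b b
    have e1 := h1 0 b
    rw [CharTwo.add_self_eq_zero, add_self2, add_comm b a] at e e1
    rw [sa, sb, sab, s0] at e
    rw [wa, wb, wab, w0] at e1
    linarith
  have hP : (2 : ℤ) ^ (2 * t) = 2 ^ t * 2 ^ t := by rw [← pow_add]; congr 1; lia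
  have hP2 : (32 : ℤ) ≤ 2 ^ t := by
    calc (32 : ℤ) = 2 ^ 5 := by norm_num
      _ ≤ 2 ^ t := pow_le_pow_right₀ (by norm_num) ht
  have hpos : (0 : ℤ) ≤ 2 ^ (2 * t) - 2 * 2 ^ t := by nlinarith
  refine ⟨A, B, ?_⟩
  intro ν
  by_cases n0 : ν = 0
  · subst n0; rw [B, abs_neg, abs_of_nonneg hpos]
  by_cases na : ν = a
  · subst na; rw [C, abs_neg, abs_of_nonneg hpos]
  by_cases nb : ν = b
  · subst nb; rw [D, abs_neg, abs_of_nonneg hpos]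
  by_cases nab : ν = a + b
  · subst nab; rw [A, abs_of_nonneg hpos]
  have e1 := h1 0 ν
  have na' : ν + a ≠ 0 := by rwa [Ne, CharTwo.add_eq_zero]
  have nb' : ν + b ≠ 0 := by rwa [Ne, CharTwo.add_eq_zero]
  have nab' : ν + a + b ≠ 0 := by rwa [add_assoc, Ne, CharTwo.add_eq_zero]
  rw [wal_zero i _ n0, wal_zero i _ na', wal_zero i _ nb', wal_zero i _ nab'] at e1
  rw [e1]
  have := abs_le.mp (se_bound t i ht0 a b 0 ν)
  rw [abs_le]
  constructor <;> nlinarith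

end sums

lemma wt_eq (n : ℕ) [Fintype (GaloisField 2 n)] (hc : Fintype.card (GaloisField 2 n) = 2 ^ n)
    (φ : GaloisField 2 n → ZMod 2) (h0 : φ 0 = 0) :
    2 * (wtK n (fun x => φ x.1) : ℤ) = 2 ^ n - ∑ x, sgn (φ x) := by
  classical
  have h1 : wtK n (fun x => φ x.1) = #{x : GaloisField 2 n | φ x = 1} := by
    rw [wtK, ← Set.ncard_image_of_injective _ Subtype.val_injective, ← Set.ncard_coe_finset]
    congr 1
    ext x
    simp only [Set.mem_image, Subtype.exists, Finset.coe_filter, Finset.mem_univ, true_and]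
    constructor
    · rintro ⟨y, hy, h, rfl⟩; exact h
    · intro h
      refine ⟨x, ?_, h, rfl⟩
      rintro rfl
      have h : φ 0 = 1 := h
      rw [h0] at h
      exact absurd h (by decide)
  have h2 : ∀ u : ZMod 2, sgn u = 1 - 2 * (if u = 1 then 1 else 0) := by decide
  simp_rw [h2]
  rw [Finset.sum_sub_distrib, ← Finset.mul_sum, Finset.sum_boole, h1]
  simp [hc]

lemma gs_implies {F : Type*} [Fintype F] (u v : F → ZMod 2) (h : ∀ x, v x = 1 → u x = 1) :
    ∑ x, sgn (v x) + ∑ x, sgn (u x + v x) - ∑ x, sgn (u x) = Fintype.card F := by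
  rw [← Finset.sum_add_distrib, ← Finset.sum_sub_distrib]
  have : ∀ x, sgn (v x) + sgn (u x + v x) - sgn (u x) = 1 := by
    intro x
    have := h x
    generalize u x = a at *
    generalize v x = b at *
    revert a b; decide
  simp [this]

open scoped Classical in
theorem stmt18 (t n i lam : ℕ) (hn : n = 2 * t) (hn8 : 8 < n)
    (hi1 : 2 ≤ i) (hi2 : i ≤ n - 1)
    (hlam : lam = Nat.gcd n i) (hodd : Odd (n / lam))
    (a b : GaloisField 2 n)
    (haE : ¬ a ^ (2 ^ t) = a) (hbE : ¬ b ^ (2 ^ t) = b)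
    (habE : ¬ (a + b) ^ (2 ^ t) = a + b)
    (f : GaloisField 2 n → ZMod 2)
    (hf : ∀ x, f x = (if x ^ (2 ^ t) = x then (1 : ZMod 2) else 0)
      + trK n (a * x) * trK n (b * x) + 1) :
    IsMinimalK n (codeG n i f) ∧
    Nat.card (codeG n i f) = 2 ^ (2 * n + 1) ∧
    IsLeast (weightsG n i f) (2 ^ (n - 2) + 2 ^ (t - 1)) ∧
    (∀ wmin wmax : ℕ, IsLeast (weightsG n i f) wmin →
      IsGreatest (weightsG n i f) wmax → 2 * wmin ≤ wmax) := by
  letI : Fintype (GaloisField 2 n) := Fintype.ofFinite _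
  have hc : Fintype.card (GaloisField 2 n) = 2 ^ n := by
    rw [← Nat.card_eq_fintype_card]; exact GaloisField.card 2 n (by lia)
  have hc2 : Fintype.card (GaloisField 2 n) = 2 ^ (2 * t) := by rw [hc, hn]
  have hgcd := gcd_bound t n i hn hn8 hi1 hi2 (hlam ▸ hodd)
  have hwal := fun μ ν => wal_bound (F := GaloisField 2 n) n i (by lia) (by lia) hc hgcd μ ν
  have h1 := gs_one t i a b f hf
  obtain ⟨sA, sB, sC⟩ := special t i (by lia) hc2 a b haE hbE habE f h1
  rw [← hn] at sA sB sC
  -- numerical parameters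
  obtain ⟨M, hM⟩ : ∃ M : ℤ, M = 2 ^ (n - 4) := ⟨_, rfl⟩
  obtain ⟨P, hP⟩ : ∃ P : ℤ, P = 2 ^ t := ⟨_, rfl⟩
  have hP32 : 32 ≤ P := by
    rw [hP]
    calc (32 : ℤ) = 2 ^ 5 := by norm_num
      _ ≤ 2 ^ t := pow_le_pow_right₀ (by norm_num) (by lia)
  have hMP : 2 * P ≤ M := by
    rw [hP, hM, ← pow_succ']
    exact pow_le_pow_right₀ (by norm_num) (by lia)
  have h2n : (2 : ℤ) ^ n = 16 * M := by
    rw [hM, show (16 : ℤ) = 2 ^ 4 by norm_num, ← pow_add]; congr 1; lia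
  rw [h2n, ← hP] at sA sB sC
  -- bounds
  have b1 : ∀ ν, ν ≠ 0 → gs i f 0 0 ν = 0 := fun ν hν => by rw [gs_zero, wal_zero i ν hν]
  have b2 : ∀ μ ν, μ ≠ 0 → |gs i f 0 μ ν| ≤ M := fun μ ν hμ => by
    rw [gs_zero, hM]; exact hwal μ ν hμ
  have b3 : ∀ μ ν, μ ≠ 0 → |gs i f 1 μ ν| ≤ 3 * M := fun μ ν hμ => by
    have e := h1 μ ν
    have x1 := abs_le.mp (hwal μ ν hμ)
    have x2 := abs_le.mp (hwal μ (ν + a) hμ)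
    have x3 := abs_le.mp (hwal μ (ν + b) hμ)
    have x4 := abs_le.mp (hwal μ (ν + a + b) hμ)
    have x5 := abs_le.mp (se_bound t i (by lia) a b μ ν)
    rw [← hM] at x1 x2 x3 x4
    rw [← hP] at x5
    rw [abs_le]
    constructor <;> linarith
  have b4 : ∀ ν, |gs i f 1 0 ν| ≤ 8 * M - P := fun ν => by
    have := abs_le.mp (sC ν)
    rw [abs_le]
    constructor <;> linarith
  have b34 : ∀ μ ν, |gs i f 1 μ ν| ≤ 8 * M - P := fun μ ν => by
    by_cases hμ : μ = 0
    · subst hμ; exact b4 ν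
    · have := b3 μ ν hμ; linarith
  have b12 : ∀ μ ν, ¬ (μ = 0 ∧ ν = 0) → |gs i f 0 μ ν| ≤ M := fun μ ν h => by
    by_cases hμ : μ = 0
    · subst hμ
      rw [b1 ν (fun h' => h ⟨rfl, h'⟩)]; simp; linarith
    · exact b2 μ ν hμ
  have two : ∀ u : ZMod 2, u = 0 ∨ u = 1 := by decide
  have ball : ∀ (m : ZMod 2) (μ ν : GaloisField 2 n), ¬ (m = 0 ∧ μ = 0 ∧ ν = 0) →
      |gs i f m μ ν| ≤ 8 * M - P := by
    intro m μ ν h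
    rcases two m with rfl | rfl
    · have := b12 μ ν (fun h' => h ⟨rfl, h'⟩); linarith
    · exact b34 μ ν
  -- extended codewords
  have f0 : f 0 = 0 := by
    rw [hf]; simp [trK]; decide
  have ph0 : ∀ m μ ν, ph i f m μ ν 0 = 0 := by
    intro m μ ν; simp [ph, f0, tr_zero]
  have cw : ∀ m μ ν, cwG n i f m μ ν = fun x => ph i f m μ ν x.1 := fun m μ ν => rfl
  have hwt : ∀ m μ ν, 2 * (wtK n (cwG n i f m μ ν) : ℤ) = 16 * M - gs i f m μ ν := by
    intro m μ ν
    rw [cw, wt_eq n hc _ (ph0 m μ ν), h2n]; rfl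
  have phadd : ∀ m μ ν m' μ' ν' x, ph i f m μ ν x + ph i f m' μ' ν' x
      = ph i f (m + m') (μ + μ') (ν + ν') x := by
    intro m μ ν m' μ' ν' x
    simp only [ph, add_mul, tr_add]; ring
  have cwzero : cwG n i f 0 0 0 = 0 := by
    rw [cw]; funext x; simp [ph, tr_zero]
  have wtzero : wtK n 0 = 0 := by
    have : {x : {x : GaloisField 2 n // x ≠ 0} | (0 : {x : GaloisField 2 n // x ≠ 0} → ZMod 2) x
        = 1} = ∅ := by
      ext x; simp
    rw [wtK, this, Set.ncard_empty]
  have cwne : ∀ m μ ν, ¬ (m = 0 ∧ μ = 0 ∧ ν = 0) → cwG n i f m μ ν ≠ 0 := by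
    intro m μ ν h h'
    have e := hwt m μ ν
    rw [h', wtzero] at e
    have := abs_le.mp (ball m μ ν h)
    push_cast at e
    linarith
  have eqz : ∀ x y : GaloisField 2 n, x + y = 0 → x = y := fun x y h => CharTwo.add_eq_zero.mp h
  have eqz2 : ∀ x y : ZMod 2, x + y = 0 → x = y := by decide
  have inj : Function.Injective (fun p : ZMod 2 × GaloisField 2 n × GaloisField 2 n =>
      cwG n i f p.1 p.2.1 p.2.2) := by
    rintro ⟨m, μ, ν⟩ ⟨m', μ', ν'⟩ h
    simp only at h
    have h0 : cwG n i f (m + m') (μ + μ') (ν + ν') = 0 := by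
      rw [cw]; funext x
      rw [← phadd]
      have := congrFun h x
      rw [cw, cw] at this
      simp only at this
      rw [this]; exact CharTwo.add_self_eq_zero _
    by_contra hne
    refine cwne _ _ _ ?_ h0
    rintro ⟨e1, e2, e3⟩
    exact hne (by rw [eqz2 _ _ e1, eqz _ _ e2, eqz _ _ e3])
  have hminw : ∃ w : ℕ, w = 2 ^ (n - 2) + 2 ^ (t - 1) := ⟨_, rfl⟩
  obtain ⟨w, hw⟩ := hminw
  have hw2 : 2 * (w : ℤ) = 8 * M + P := by
    rw [hw, hM, hP]
    push_cast
    rw [mul_add, ← pow_succ', ← pow_succ', show (8 : ℤ) = 2 ^ 3 by norm_num, ← pow_add]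
    congr 2 <;> lia
  have habne : ¬ ((1 : ZMod 2) = 0 ∧ (0 : GaloisField 2 n) = 0 ∧ a + b = 0) := by
    rintro ⟨h, -⟩; exact absurd h (by decide)
  have h0ne : ¬ ((1 : ZMod 2) = 0 ∧ (0 : GaloisField 2 n) = 0 ∧ (0 : GaloisField 2 n) = 0) := by
    rintro ⟨h, -⟩; exact absurd h (by decide)
  have hleast : IsLeast (weightsG n i f) w := by
    constructor
    · refine ⟨cwG n i f 1 0 (a + b), ⟨(1, 0, a + b), rfl⟩, cwne _ _ _ habne, ?_⟩
      have := hwt 1 0 (a + b)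
      zify; linarith
    · rintro v ⟨c, ⟨⟨m, μ, ν⟩, rfl⟩, hne, rfl⟩
      simp only at hne ⊢
      have hp : ¬ (m = 0 ∧ μ = 0 ∧ ν = 0) := by
        rintro ⟨rfl, rfl, rfl⟩; exact hne cwzero
      have := hwt m μ ν
      have := abs_le.mp (ball m μ ν hp)
      zify; linarith
  refine ⟨?_, ?_, ?_, ?_⟩
  · rintro _ ⟨⟨m, μ, ν⟩, rfl⟩ _ ⟨⟨m', μ', ν'⟩, rfl⟩ hne hne' hsub
    simp only at hne hne' hsub ⊢
    have hp : ¬ (m = 0 ∧ μ = 0 ∧ ν = 0) := by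
      rintro ⟨rfl, rfl, rfl⟩; exact hne cwzero
    have hp' : ¬ (m' = 0 ∧ μ' = 0 ∧ ν' = 0) := by
      rintro ⟨rfl, rfl, rfl⟩; exact hne' cwzero
    by_cases hp'' : m + m' = 0 ∧ μ + μ' = 0 ∧ ν + ν' = 0
    · obtain ⟨e1, e2, e3⟩ := hp''
      rw [eqz2 _ _ e1, eqz _ _ e2, eqz _ _ e3]
    exfalso
    have himp : ∀ x, ph i f m' μ' ν' x = 1 → ph i f m μ ν x = 1 := by
      intro x hx
      by_cases hx0 : x = 0
      · subst hx0; rw [ph0] at hx; exact absurd hx (by decide)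
      · exact hsub (a := (⟨x, hx0⟩ : {x : GaloisField 2 n // x ≠ 0})) hx
    have hsum := gs_implies _ _ himp
    simp_rw [phadd] at hsum
    rw [hc] at hsum
    push_cast at hsum
    rw [h2n] at hsum
    change gs i f m' μ' ν' + gs i f (m + m') (μ + μ') (ν + ν') - gs i f m μ ν = 16 * M at hsum
    -- triple bound: elements p, q with first coordinate 1 whose sum is r
    have triple : ∀ μ ν μ' ν' μ'' ν'' : GaloisField 2 n, ¬ (μ'' = 0 ∧ ν'' = 0) → 
        μ'' = μ + μ' →
        |gs i f 1 μ ν| + |gs i f 1 μ' ν'| + |gs i f 0 μ'' ν''| < 16 * M := by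
      intro μ ν μ' ν' μ'' ν'' hne e
      by_cases h : μ'' = 0
      · have hν : ν'' ≠ 0 := fun h' => hne ⟨h, h'⟩
        rw [h, b1 _ hν, abs_zero]
        have := b34 μ ν
        have := b34 μ' ν'
        linarith
      · have x0 := b12 μ'' ν'' hne
        have x1 := b34 μ ν
        have x2 := b34 μ' ν'
        by_cases hμ : μ = 0
        · have hμ' : μ' ≠ 0 := by
            rintro rfl; exact h (by rw [e, hμ, add_zero])
          have := b3 μ' ν' hμ'
          linarith
        · have := b3 μ ν hμ
          linarith
    have y1 := abs_le.mp (le_refl |gs i f m μ ν|)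
    have y2 := abs_le.mp (le_refl |gs i f m' μ' ν'|)
    have y3 := abs_le.mp (le_refl |gs i f (m + m') (μ + μ') (ν + ν')|)
    have s11 : (1 : ZMod 2) + 1 = 0 := by decide
    rcases two m with rfl | rfl <;> rcases two m' with rfl | rfl
    · rw [add_zero] at *
      have z1 := b12 μ ν (fun h => hp ⟨rfl, h⟩)
      have z2 := b12 μ' ν' (fun h => hp' ⟨rfl, h⟩)
      have z3 := b12 _ _ (fun h => hp'' ⟨rfl, h⟩)
      linarith
    · rw [zero_add] at *
      have := triple μ' ν' (μ + μ') (ν + ν') μ ν (fun h => hp ⟨rfl, h⟩)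
        (by rw [add_comm μ μ', ← add_assoc, CharTwo.add_self_eq_zero, zero_add])
      linarith
    · rw [add_zero] at *
      have := triple μ ν (μ + μ') (ν + ν') μ' ν' (fun h => hp' ⟨rfl, h⟩)
        (by rw [← add_assoc, CharTwo.add_self_eq_zero, zero_add])
      linarith
    · rw [s11] at *
      have := triple μ ν μ' ν' _ _ (fun h => hp'' ⟨rfl, h⟩) rfl
      linarith
  · rw [codeG, ← Set.image_univ, Nat.card_image_of_injective inj]
    rw [Nat.card_univ, Nat.card_prod, Nat.card_prod, Nat.card_zmod,
      Nat.card_eq_fintype_card (α := GaloisField 2 n), hc]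
    ring
  · rw [← hw]; exact hleast
  · intro wmin wmax hmin hmax
    have e := hmin.unique hleast
    have hle := hmax.2 (show wtK n (cwG n i f 1 0 0) ∈ weightsG n i f from
      ⟨cwG n i f 1 0 0, ⟨(1, 0, 0), rfl⟩, cwne _ _ _ h0ne, rfl⟩)
    have := hwt 1 0 0
    rw [e]
    zify at hle ⊢
    linarith
end
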